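/- arXiv:math/0302276 — 10 statements merged into one kernel-verified Lean document; each statement's English description precedes it below -/
import Mathlib

section
/- Let F be a field that is an algebra over ℝ and let n ≥ 1. Points c₁,...,c_{n+1} ∈ Fⁿ are affinely dependent if and only if their Cayley–Menger determinant Δ(c₁,...,c_{n+1}) equals 0. -/
/-- `φₙ((x₁,...,xₙ),(y₁,...,yₙ)) = (x₁−y₁)² + ... + (xₙ−yₙ)²` on `Fⁿ`. -/
def phi (F : Type*) [Field F] (n : ℕ) (x y : Fin n → F) : F := ∑ i, (x i - y i) ^ 2

/-- The Cayley–Menger determinant of `m` points of `Fⁿ`: the determinant of the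
`(m+1)×(m+1)` matrix whose `(0,0)` entry is `0`, whose remaining entries in the first
row and first column are `1`, and whose `(i,j)` entry for `1 ≤ i,j ≤ m` is `φₙ(cᵢ,cⱼ)`. -/
noncomputable def cayleyMenger (F : Type*) [Field F] (n m : ℕ) (c : Fin m → Fin n → F) : F :=
  Matrix.det (Matrix.of fun i j : Fin (m + 1) =>
    if hi : i = 0 then (if j = 0 then (0 : F) else 1)
    else if hj : j = 0 then 1 else phi F n (c (i.pred hi)) (c (j.pred hj)))

/-- Points are affinely dependent iff some nonzero weights of total zero have vanishing weighted
sum. -/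
theorem not_affineIndependent_iff_exists_sum_smul_eq_zero {F V ι : Type*} [Field F]
    [AddCommGroup V] [Module F V] [Fintype ι] (c : ι → V) :
    ¬ AffineIndependent F c ↔ ∃ w : ι → F, w ≠ 0 ∧ ∑ i, w i = 0 ∧ ∑ i, w i • c i = 0 := by
  rw [affineIndependent_iff_of_fintype]
  push Not
  refine exists_congr fun w => ?_
  rw [Function.ne_iff]
  constructor
  · rintro ⟨h0, h1, hw⟩
    exact ⟨hw, h0, (Finset.univ.weightedVSub_eq_linear_combination h0).symm.trans h1⟩
  · rintro ⟨hw, h0, h1⟩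
    exact ⟨h0, (Finset.univ.weightedVSub_eq_linear_combination h0).trans h1, hw⟩

open Matrix in
/-- `n + 1` points of `Fⁿ` are affinely dependent iff the square matrix of their homogeneous
coordinates is singular. -/
theorem not_affineIndependent_iff_det_vecCons_one_eq_zero {F : Type*} [Field F] {n : ℕ}
    (c : Fin (n + 1) → Fin n → F) :
    ¬ AffineIndependent F c ↔ (Matrix.of fun i => vecCons 1 (c i)).det = 0 := by
  rw [not_affineIndependent_iff_exists_sum_smul_eq_zero, ← exists_vecMul_eq_zero_iff]
  simp [funext_iff, Fin.forall_fin_succ, vecMul, dotProduct]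

/-- For weights of total zero, the weighted sum of the squared distances from `x` is an affine
function of `x`. -/
theorem sum_phi_mul_eq {F : Type*} [Field F] {n : ℕ} {ι : Type*} [Fintype ι] (c : ι → Fin n → F)
    (x : Fin n → F) {w : ι → F} (hw : ∑ j, w j = 0) :
    ∑ j, phi F n x (c j) * w j =
      ∑ j, w j * (c j ⬝ᵥ c j) + x ⬝ᵥ ((-2 : F) • ∑ j, w j • c j) := by
  have phi_eq (y : Fin n → F) : phi F n x y = x ⬝ᵥ x + y ⬝ᵥ y - 2 * (x ⬝ᵥ y) := by
    simp only [phi, dotProduct, Finset.mul_sum, ← Finset.sum_add_distrib, ← Finset.sum_sub_distrib]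
    exact Finset.sum_congr rfl fun _ _ => by ring
  have hx : ∑ j, (x ⬝ᵥ x) * w j = 0 := by rw [← Finset.mul_sum, hw, mul_zero]
  rw [dotProduct_smul, dotProduct_sum, smul_eq_mul, Finset.mul_sum, ← zero_add (∑ j, w j * _),
    ← hx, ← Finset.sum_add_distrib, ← Finset.sum_add_distrib]
  refine Finset.sum_congr rfl fun j _ => ?_
  rw [phi_eq, dotProduct_smul, smul_eq_mul]
  ring

open Matrix in
/-- The Cayley–Menger determinant vanishes iff the Cayley–Menger matrix has a nonzero kernel
vector `(t, w)`. -/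
theorem cayleyMenger_eq_zero_iff {F : Type*} [Field F] {n m : ℕ} (c : Fin m → Fin n → F) :
    cayleyMenger F n m c = 0 ↔ ∃ (t : F) (w : Fin m → F), (t ≠ 0 ∨ w ≠ 0) ∧ ∑ j, w j = 0 ∧
      ∀ i, t + ∑ j, w j * (c j ⬝ᵥ c j) + c i ⬝ᵥ ((-2 : F) • ∑ j, w j • c j) = 0 := by
  rw [cayleyMenger, ← exists_mulVec_eq_zero_iff, Fin.exists_fin_succ_pi]
  refine exists_congr fun t => exists_congr fun w => and_congr ?_ ?_
  · rw [ne_eq, ← cons_zero_zero, ← not_and_or, not_iff_not]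
    exact Fin.cons_inj
  · rw [funext_iff, Fin.forall_fin_succ]
    simp only [mulVec, dotProduct, of_apply, Fin.sum_univ_succ, Fin.cons_zero, Fin.cons_succ,
      Fin.succ_ne_zero, Fin.pred_succ, dite_true, dite_false, if_true, if_false, Pi.zero_apply,
      zero_mul, one_mul, zero_add]
    refine and_congr_right fun hw => forall_congr' fun i => ?_
    rw [sum_phi_mul_eq c (c i) hw, ← add_assoc]
    rfl

/-- Let `F` be a field extending `ℝ` and `n ≥ 1`. Points `c₁,...,c_{n+1} ∈ Fⁿ` are
affinely dependent iff their Cayley–Menger determinant vanishes. -/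
theorem stmt3 (F : Type*) [Field F] [Algebra ℝ F] (n : ℕ) (hn : 1 ≤ n)
    (c : Fin (n + 1) → Fin n → F) :
    ¬ AffineIndependent F c ↔ cayleyMenger F n (n + 1) c = 0 := by
  have : CharZero F := charZero_of_injective_algebraMap (algebraMap ℝ F).injective
  rw [cayleyMenger_eq_zero_iff]
  constructor
  · rw [not_affineIndependent_iff_exists_sum_smul_eq_zero]
    rintro ⟨w, hw, h0, h1⟩
    exact ⟨-∑ j, w j * (c j ⬝ᵥ c j), w, Or.inr hw, h0, fun i => by simp [h1]⟩
  · rintro ⟨t, w, htw, h0, h⟩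
    have hw : w ≠ 0 := by
      rintro rfl
      have ht : t = 0 := by simpa using h 0
      simp [ht] at htw
    by_cases hu : ∑ j, w j • c j = 0
    · exact (not_affineIndependent_iff_exists_sum_smul_eq_zero c).2 ⟨w, hw, h0, hu⟩
    · rw [not_affineIndependent_iff_det_vecCons_one_eq_zero, ← Matrix.exists_mulVec_eq_zero_iff]
      refine ⟨Matrix.vecCons (t + ∑ j, w j * (c j ⬝ᵥ c j)) ((-2 : F) • ∑ j, w j • c j),
        fun hv => ?_, funext fun i => ?_⟩
      · have hv' : (-2 : F) • ∑ j, w j • c j = 0 := funext fun i => congrFun hv i.succ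
        exact (smul_ne_zero (neg_ne_zero.2 two_ne_zero) hu) hv'
      · refine (Matrix.cons_dotProduct_cons ..).trans ?_
        rw [one_mul]
        exact h i
end

section
/- Let F be a field that is an algebra over ℝ, let n ≥ 1 and k ≥ 2. For any points c₁,...,c_{n+k} ∈ Fⁿ, their Cayley–Menger determinant equals 0: Δ(c₁,...,c_{n+k}) = 0. -/
/-- More than `n + 1` points of `Fⁿ` satisfy a nontrivial affine relation. -/
theorem exists_affine_relation {F : Type*} [Field F] {n m : ℕ} (h : n + 1 < m)
    (c : Fin m → Fin n → F) :
    ∃ w : Fin m → F, w ≠ 0 ∧ ∑ j, w j = 0 ∧ ∀ l, ∑ j, c j l * w j = 0 := by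
  let A : Matrix (Option (Fin n)) (Fin m) F :=
    Matrix.of fun o j => o.elim 1 fun l => c j l
  have hker : LinearMap.ker A.mulVecLin ≠ ⊥ :=
    LinearMap.ker_ne_bot_of_finrank_lt (by simpa using h)
  obtain ⟨w, hw, hw0⟩ := (Submodule.ne_bot_iff _).1 hker
  have hA : A.mulVec w = 0 := hw
  refine ⟨w, hw0, ?_, fun l => ?_⟩
  · simpa [A, Matrix.mulVec, dotProduct] using congrFun hA none
  · simpa [A, Matrix.mulVec, dotProduct] using congrFun hA (some l)

/-- Averaging `phi` against an affine relation gives a value independent of the base point. -/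
theorem sum_phi_mul_of_affine_relation {F : Type*} [Field F] {n m : ℕ}
    {c : Fin m → Fin n → F} {w : Fin m → F} (hsum : ∑ j, w j = 0)
    (hc : ∀ l, ∑ j, c j l * w j = 0) (x : Fin n → F) :
    ∑ j, phi F n x (c j) * w j = ∑ l, ∑ j, c j l ^ 2 * w j := by
  simp only [phi, Finset.sum_mul]
  rw [Finset.sum_comm]
  refine Finset.sum_congr rfl fun l _ => ?_
  calc ∑ j, (x l - c j l) ^ 2 * w j
      = ∑ j, (x l ^ 2 * w j - 2 * x l * (c j l * w j) + c j l ^ 2 * w j) :=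
        Finset.sum_congr rfl fun j _ => by ring
    _ = ∑ j, c j l ^ 2 * w j := by
        rw [Finset.sum_add_distrib, Finset.sum_sub_distrib, ← Finset.mul_sum,
          ← Finset.mul_sum, hsum, hc]
        ring

/-- Let `F` be a field extending `ℝ`, `n ≥ 1`, `k ≥ 2`. For any points
`c₁,...,c_{n+k} ∈ Fⁿ`, their Cayley–Menger determinant vanishes. -/
theorem stmt4 (F : Type*) [Field F] [Algebra ℝ F] (n k : ℕ) (hn : 1 ≤ n) (hk : 2 ≤ k)
    (c : Fin (n + k) → Fin n → F) :
    cayleyMenger F n (n + k) c = 0 := by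
  obtain ⟨w, hw0, hsum, hc⟩ := exists_affine_relation (by omega) c
  refine Matrix.exists_mulVec_eq_zero_iff.1
    ⟨Fin.cons (-∑ l, ∑ j, c j l ^ 2 * w j) w, fun h => hw0 ?_, ?_⟩
  · funext j
    simpa using congrFun h j.succ
  · funext i
    refine Fin.cases ?_ (fun i => ?_) i
    · simp [Matrix.mulVec, dotProduct, Fin.sum_univ_succ, hsum]
    · simp [Matrix.mulVec, dotProduct, Fin.sum_univ_succ,
        sum_phi_mul_of_affine_relation hsum hc]
end

section
/- Let F be a field that is an algebra over ℝ. If d ∈ F, d ≠ 0, and c₁, c₂, c₃ ∈ F² satisfy φ₂(c₁,c₂) = φ₂(c₁,c₃) = φ₂(c₂,c₃) = d², then c₁, c₂, c₃ are affinely independent. -/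
/-- `φ₂((x₁,x₂),(y₁,y₂)) = (x₁−y₁)² + (x₂−y₂)²` on `F²`. -/
def phi2 (F : Type*) [Field F] (x y : Fin 2 → F) : F := (x 0 - y 0) ^ 2 + (x 1 - y 1) ^ 2

/-- Let `F` be a field extending `ℝ`. If `d ∈ F`, `d ≠ 0`, and `c₁, c₂, c₃ ∈ F²`
satisfy `φ₂(c₁,c₂) = φ₂(c₁,c₃) = φ₂(c₂,c₃) = d²`, then `c₁, c₂, c₃` are affinely
independent. -/
theorem stmt5 (F : Type*) [Field F] [Algebra ℝ F] (d : F) (hd : d ≠ 0)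
    (c₁ c₂ c₃ : Fin 2 → F)
    (h12 : phi2 F c₁ c₂ = d ^ 2) (h13 : phi2 F c₁ c₃ = d ^ 2)
    (h23 : phi2 F c₂ c₃ = d ^ 2) :
    AffineIndependent F ![c₁, c₂, c₃] := by
  have : CharZero F := Algebra.charZero_of_charZero ℝ F
  rw [affineIndependent_iff_not_collinear_set, collinear_iff_exists_forall_eq_smul_vadd]
  rintro ⟨p, v, h⟩
  obtain ⟨r₁, rfl⟩ := h c₁ (by simp)
  obtain ⟨r₂, rfl⟩ := h c₂ (by simp)
  obtain ⟨r₃, rfl⟩ := h c₃ (by simp)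
  simp only [phi2, vadd_eq_add, Pi.add_apply, Pi.smul_apply, smul_eq_mul] at h12 h13 h23
  set N := v 0 ^ 2 + v 1 ^ 2 with hN
  have e12 : (r₁ - r₂) ^ 2 * N = d ^ 2 := by rw [← h12, hN]; ring
  have e23 : (r₂ - r₃) ^ 2 * N = d ^ 2 := by rw [← h23, hN]; ring
  have e13 : 2 * ((r₁ - r₂) * (r₂ - r₃) * N) = -d ^ 2 := by
    linear_combination h13 - h12 - h23
  have e : 3 * d ^ 4 = 0 := by
    linear_combination (2 * ((r₁ - r₂) * (r₂ - r₃) * N) - d ^ 2) * e13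
      - 4 * (r₂ - r₃) ^ 2 * N * e12 - 4 * d ^ 2 * e23
  simp [hd] at e
end

section
/- Let F be a field that is an algebra over ℝ. If a, b ∈ F with a + b ≠ 0, and z, x, x̃ ∈ F² satisfy φ₂(z,x) = a², φ₂(x,x̃) = b², and φ₂(z,x̃) = (a+b)², then x − z = (a/(a+b)) • (x̃ − z). -/
/-- In a plane, an isotropic vector orthogonal to an anisotropic vector vanishes. -/
lemma eq_zero_of_isotropic_of_orthogonal {F : Type*} [Field F] {p q s t : F}
    (hw : p ^ 2 + q ^ 2 = 0) (ho : p * s + q * t = 0) (hs : s ^ 2 + t ^ 2 ≠ 0) :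
    p = 0 ∧ q = 0 := by
  constructor
  · have h : p ^ 2 * (s ^ 2 + t ^ 2) = 0 := by
      linear_combination (p * s - q * t) * ho + t ^ 2 * hw
    exact pow_eq_zero_iff two_ne_zero |>.1 ((mul_eq_zero.1 h).resolve_right hs)
  · have h : q ^ 2 * (s ^ 2 + t ^ 2) = 0 := by
      linear_combination (q * t - p * s) * ho + s ^ 2 * hw
    exact pow_eq_zero_iff two_ne_zero |>.1 ((mul_eq_zero.1 h).resolve_right hs)

/-- Let `F` be a field extending `ℝ`. If `a, b ∈ F` with `a + b ≠ 0`, and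
`z, x, x̃ ∈ F²` satisfy `φ₂(z,x) = a²`, `φ₂(x,x̃) = b²`, `φ₂(z,x̃) = (a+b)²`, then
`x − z = (a/(a+b)) • (x̃ − z)`. -/
theorem stmt6 (F : Type*) [Field F] [Algebra ℝ F] (a b : F) (hab : a + b ≠ 0)
    (z x xt : Fin 2 → F)
    (h1 : phi2 F z x = a ^ 2) (h2 : phi2 F x xt = b ^ 2)
    (h3 : phi2 F z xt = (a + b) ^ 2) :
    x - z = (a / (a + b)) • (xt - z) := by
  have : CharZero F := charZero_of_injective_algebraMap (algebraMap ℝ F).injective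
  unfold phi2 at h1 h2 h3
  have hus : (x 0 - z 0) * (xt 0 - z 0) + (x 1 - z 1) * (xt 1 - z 1) = a * (a + b) := by
    apply mul_left_cancel₀ (two_ne_zero (α := F))
    linear_combination h1 + h3 - h2
  have hss : (xt 0 - z 0) ^ 2 + (xt 1 - z 1) ^ 2 ≠ 0 := by
    have h : (xt 0 - z 0) ^ 2 + (xt 1 - z 1) ^ 2 = (a + b) ^ 2 := by linear_combination h3
    rw [h]
    exact pow_ne_zero 2 hab
  obtain ⟨hw0, hw1⟩ := eq_zero_of_isotropic_of_orthogonal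
    (p := (a + b) * (x 0 - z 0) - a * (xt 0 - z 0))
    (q := (a + b) * (x 1 - z 1) - a * (xt 1 - z 1))
    (by linear_combination (a + b) ^ 2 * h1 + a ^ 2 * h3 - 2 * a * (a + b) * hus)
    (by linear_combination (a + b) * hus - a * h3) hss
  funext i
  simp only [Pi.sub_apply, Pi.smul_apply, smul_eq_mul]
  rw [div_mul_eq_mul_div, eq_div_iff hab]
  revert i
  exact Fin.forall_fin_two.2 ⟨by linear_combination hw0, by linear_combination hw1⟩
end

section
/- Let F be a field that is an algebra over ℝ. If x, y, c₀, c₁, c₂ ∈ F² satisfy φ₂(x,c₀) = φ₂(y,c₀), φ₂(x,c₁) = φ₂(y,c₁), φ₂(x,c₂) = φ₂(y,c₂), and c₀, c₁, c₂ are affinely independent, then x = y. -/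
/-- Affine independence of three points of the plane gives a nonzero determinant of the
difference vectors. -/
theorem AffineIndependent.det_vsub_ne_zero {F : Type*} [Field F] {c₀ c₁ c₂ : Fin 2 → F}
    (h : AffineIndependent F ![c₀, c₁, c₂]) :
    (c₁ 0 - c₀ 0) * (c₂ 1 - c₀ 1) - (c₁ 1 - c₀ 1) * (c₂ 0 - c₀ 0) ≠ 0 := by
  intro hdet
  have key (a b : F) (hab : ∀ i, a * (c₁ i - c₀ i) + b * (c₂ i - c₀ i) = 0) : a = 0 ∧ b = 0 := by
    rw [affineIndependent_iff] at h
    have hw := h Finset.univ ![-a - b, a, b] (by simp [Fin.sum_univ_three]; ring) (by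
      ext i
      simp only [Fin.sum_univ_three, Matrix.cons_val, Pi.add_apply, Pi.smul_apply, smul_eq_mul,
        Pi.zero_apply]
      linear_combination hab i)
    exact ⟨hw 1 (Finset.mem_univ _), hw 2 (Finset.mem_univ _)⟩
  have hz (j : Fin 2) := key (c₂ j - c₀ j) (-(c₁ j - c₀ j)) (by
    intro i
    fin_cases i <;> fin_cases j <;> simp only [Fin.zero_eta, Fin.mk_one]
    · ring
    · linear_combination hdet
    · linear_combination -hdet
    · ring)
  exact one_ne_zero (key 1 0 fun i => by linear_combination -(hz i).2).1

/-- Let `F` be a field extending `ℝ`. If `x, y, c₀, c₁, c₂ ∈ F²` satisfy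
`φ₂(x,cᵢ) = φ₂(y,cᵢ)` for `i = 0, 1, 2` and `c₀, c₁, c₂` are affinely independent,
then `x = y`. -/
theorem stmt7 (F : Type*) [Field F] [Algebra ℝ F] (x y c₀ c₁ c₂ : Fin 2 → F)
    (h0 : phi2 F x c₀ = phi2 F y c₀) (h1 : phi2 F x c₁ = phi2 F y c₁)
    (h2 : phi2 F x c₂ = phi2 F y c₂)
    (hind : AffineIndependent F ![c₀, c₁, c₂]) :
    x = y := by
  have : CharZero F := charZero_of_injective_algebraMap (algebraMap ℝ F).injective
  have hdet := hind.det_vsub_ne_zero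
  unfold phi2 at h0 h1 h2
  have two_ne : (2 : F) ≠ 0 := two_ne_zero
  have orth₁ : (x 0 - y 0) * (c₁ 0 - c₀ 0) + (x 1 - y 1) * (c₁ 1 - c₀ 1) = 0 :=
    mul_left_cancel₀ two_ne (by linear_combination h0 - h1)
  have orth₂ : (x 0 - y 0) * (c₂ 0 - c₀ 0) + (x 1 - y 1) * (c₂ 1 - c₀ 1) = 0 :=
    mul_left_cancel₀ two_ne (by linear_combination h0 - h2)
  have eq₀ : x 0 - y 0 = 0 := mul_left_cancel₀ hdet (by
    linear_combination (c₂ 1 - c₀ 1) * orth₁ - (c₁ 1 - c₀ 1) * orth₂)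
  have eq₁ : x 1 - y 1 = 0 := mul_left_cancel₀ hdet (by
    linear_combination (c₁ 0 - c₀ 0) * orth₂ - (c₂ 0 - c₀ 0) * orth₁)
  ext i
  fin_cases i
  · exact sub_eq_zero.mp eq₀
  · exact sub_eq_zero.mp eq₁
end

section
/- Let F be a field that is an algebra over ℝ. If d ∈ D₂(F), then √3 · d ∈ D₂(F). -/
/-- `D₂(F)`: the set of all real `d > 0` such that for all `x, y ∈ ℝ²` with
`|x−y| = d` there is a finite set `S` with `{x,y} ⊆ S ⊆ ℝ²` such that every map
`f : S → F²` preserving unit distance satisfies `φ₂(f(x),f(y)) = d²`. -/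
def D2 (F : Type*) [Field F] [Algebra ℝ F] : Set ℝ :=
  {d | 0 < d ∧ ∀ x y : EuclideanSpace ℝ (Fin 2), dist x y = d →
    ∃ S : Set (EuclideanSpace ℝ (Fin 2)), S.Finite ∧ x ∈ S ∧ y ∈ S ∧
      ∀ f : EuclideanSpace ℝ (Fin 2) → (Fin 2 → F),
        (∀ u ∈ S, ∀ v ∈ S, dist u v = 1 → phi2 F (f u) (f v) = 1) →
        phi2 F (f x) (f y) = algebraMap ℝ F (d ^ 2)}

theorem dist_eq_iff_sq_add_sq {x y : EuclideanSpace ℝ (Fin 2)} {r : ℝ} (hr : 0 ≤ r) :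
    dist x y = r ↔ (x 0 - y 0) ^ 2 + (x 1 - y 1) ^ 2 = r ^ 2 := by
  rw [EuclideanSpace.dist_eq, Fin.sum_univ_two, Real.dist_eq, Real.dist_eq, sq_abs, sq_abs,
    Real.sqrt_eq_iff_eq_sq (by positivity) hr]

/-- The short diagonal `p q` of a rhombus of side `d` with long diagonal `x y`. -/
theorem exists_rhombus {x y : EuclideanSpace ℝ (Fin 2)} {d : ℝ} (hd : 0 ≤ d)
    (h : dist x y = √3 * d) :
    ∃ p q : EuclideanSpace ℝ (Fin 2),
      dist x p = d ∧ dist x q = d ∧ dist y p = d ∧ dist y q = d ∧ dist p q = d := by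
  rw [dist_eq_iff_sq_add_sq (by positivity), mul_pow, Real.sq_sqrt (by norm_num)] at h
  have h3 : √3 ^ 2 = (3 : ℝ) := Real.sq_sqrt (by norm_num)
  refine ⟨!₂[(x 0 + y 0) / 2 - √3 / 6 * (y 1 - x 1), (x 1 + y 1) / 2 + √3 / 6 * (y 0 - x 0)],
    !₂[(x 0 + y 0) / 2 + √3 / 6 * (y 1 - x 1), (x 1 + y 1) / 2 - √3 / 6 * (y 0 - x 0)],
    ?_, ?_, ?_, ?_, ?_⟩ <;> rw [dist_eq_iff_sq_add_sq hd] <;> simp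
  iterate 4 linear_combination 1 / 3 * h + ((x 0 - y 0) ^ 2 + (x 1 - y 1) ^ 2) / 36 * h3
  linear_combination 1 / 3 * h + ((x 0 - y 0) ^ 2 + (x 1 - y 1) ^ 2) / 9 * h3

/-- An isosceles triangle with two sides of length `√3 * d` and base `d`. -/
theorem exists_isosceles {x y : EuclideanSpace ℝ (Fin 2)} {d : ℝ} (hd : 0 ≤ d)
    (h : dist x y = √3 * d) :
    ∃ z : EuclideanSpace ℝ (Fin 2), dist x z = √3 * d ∧ dist y z = d := by
  rw [dist_eq_iff_sq_add_sq (by positivity), mul_pow, Real.sq_sqrt (by norm_num)] at h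
  have h11 : √11 ^ 2 = (11 : ℝ) := Real.sq_sqrt (by norm_num)
  refine ⟨!₂[x 0 + (5 / 6 * (y 0 - x 0) - √11 / 6 * (y 1 - x 1)),
    x 1 + (5 / 6 * (y 1 - x 1) + √11 / 6 * (y 0 - x 0))], ?_, ?_⟩
  · rw [dist_eq_iff_sq_add_sq (by positivity), mul_pow, Real.sq_sqrt (by norm_num)]
    simp
    linear_combination h + ((x 0 - y 0) ^ 2 + (x 1 - y 1) ^ 2) / 36 * h11
  · rw [dist_eq_iff_sq_add_sq hd]
    simp
    linear_combination 1 / 3 * h + ((x 0 - y 0) ^ 2 + (x 1 - y 1) ^ 2) / 36 * h11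

/-- Two apexes of equilateral triangles over a common side coincide or are opposite. -/
theorem eq_or_phi2_eq_of_equilateral {F : Type*} [Field F] [CharZero F] {x y p q : Fin 2 → F}
    {D : F} (hD : D ≠ 0) (hxp : phi2 F x p = D) (hxq : phi2 F x q = D) (hyp : phi2 F y p = D)
    (hyq : phi2 F y q = D) (hpq : phi2 F p q = D) : x = y ∨ phi2 F x y = 3 * D := by
  unfold phi2 at *
  obtain ⟨a, ha⟩ : ∃ a, a = x 0 - p 0 := ⟨_, rfl⟩
  obtain ⟨b, hb⟩ : ∃ b, b = x 1 - p 1 := ⟨_, rfl⟩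
  obtain ⟨a', ha'⟩ : ∃ a, a = y 0 - p 0 := ⟨_, rfl⟩
  obtain ⟨b', hb'⟩ : ∃ b, b = y 1 - p 1 := ⟨_, rfl⟩
  obtain ⟨u, hu⟩ : ∃ u, u = q 0 - p 0 := ⟨_, rfl⟩
  obtain ⟨v, hv⟩ : ∃ v, v = q 1 - p 1 := ⟨_, rfl⟩
  have hw : u ^ 2 + v ^ 2 = D := by rw [hu, hv, ← hpq]; ring
  have hX : a ^ 2 + b ^ 2 = D := by rw [ha, hb, ← hxp]
  have hY : a' ^ 2 + b' ^ 2 = D := by rw [ha', hb', ← hyp]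
  have hXw : 2 * (a * u + b * v) = D := by
    rw [ha, hb, hu, hv]; linear_combination hxp - hxq + hpq
  have hYw : 2 * (a' * u + b' * v) = D := by
    rw [ha', hb', hu, hv]; linear_combination hyp - hyq + hpq
  have hdot : (a - a') * u + (b - b') * v = 0 := by
    have : (2 : F) * ((a - a') * u + (b - b') * v) = 0 := by linear_combination hXw - hYw
    simpa using this
  have hcross : (2 * (a * v - b * u)) ^ 2 = 3 * D ^ 2 := by
    linear_combination 4 * (u ^ 2 + v ^ 2) * hX + 4 * D * hw - (2 * (a * u + b * v) + D) * hXw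
  have hcross' : (2 * (a' * v - b' * u)) ^ 2 = 3 * D ^ 2 := by
    linear_combination 4 * (u ^ 2 + v ^ 2) * hY + 4 * D * hw - (2 * (a' * u + b' * v) + D) * hYw
  rcases sq_eq_sq_iff_eq_or_eq_neg.mp (hcross.trans hcross'.symm) with h | h
  · left
    have h' : (a - a') * v - (b - b') * u = 0 := by
      have : (2 : F) * ((a - a') * v - (b - b') * u) = 0 := by linear_combination h
      simpa using this
    have h0 : D * (x 0 - y 0) = 0 := by
      have : x 0 - y 0 = a - a' := by rw [ha, ha']; ring
      rw [this]; linear_combination u * hdot + v * h' - (a - a') * hw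
    have h1 : D * (x 1 - y 1) = 0 := by
      have : x 1 - y 1 = b - b' := by rw [hb, hb']; ring
      rw [this]; linear_combination v * hdot - u * h' - (b - b') * hw
    ext i
    fin_cases i
    · exact sub_eq_zero.mp ((mul_eq_zero.mp h0).resolve_left hD)
    · exact sub_eq_zero.mp ((mul_eq_zero.mp h1).resolve_left hD)
  · right
    have e0 : x 0 - y 0 = a - a' := by rw [ha, ha']; ring
    have e1 : x 1 - y 1 = b - b' := by rw [hb, hb']; ring
    rw [e0, e1]
    apply mul_left_cancel₀ hD
    have hs : (a - a') * v - (b - b') * u = 2 * (a * v - b * u) := by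
      have : (2 : F) * ((a - a') * v - (b - b') * u - 2 * (a * v - b * u)) = 0 := by
        linear_combination -h
      simpa [sub_eq_zero] using this
    linear_combination (-((a - a') ^ 2 + (b - b') ^ 2)) * hw
      + ((a - a') * u + (b - b') * v) * hdot
      + ((a - a') * v - (b - b') * u + 2 * (a * v - b * u)) * hs + hcross

/-- A map preserving unit distance on a suitable finite set sends two points at distance `√3 * d`
to points that coincide or satisfy `phi2 = 3 * d ^ 2`. -/
theorem exists_finite_eq_or_phi2_eq {F : Type*} [Field F] [Algebra ℝ F] {d : ℝ} (hd : d ∈ D2 F)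
    {x y : EuclideanSpace ℝ (Fin 2)} (h : dist x y = √3 * d) :
    ∃ S : Set (EuclideanSpace ℝ (Fin 2)), S.Finite ∧ x ∈ S ∧ y ∈ S ∧
      ∀ f : EuclideanSpace ℝ (Fin 2) → (Fin 2 → F),
        (∀ u ∈ S, ∀ v ∈ S, dist u v = 1 → phi2 F (f u) (f v) = 1) →
        f x = f y ∨ phi2 F (f x) (f y) = 3 * algebraMap ℝ F (d ^ 2) := by
  have : CharZero F := charZero_of_injective_algebraMap (algebraMap ℝ F).injective
  obtain ⟨p, q, hxp, hxq, hyp, hyq, hpq⟩ := exists_rhombus hd.1.le h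
  obtain ⟨A, fA, xA, -, HA⟩ := hd.2 x p hxp
  obtain ⟨B, fB, -, -, HB⟩ := hd.2 x q hxq
  obtain ⟨C, fC, yC, -, HC⟩ := hd.2 y p hyp
  obtain ⟨E, fE, -, -, HE⟩ := hd.2 y q hyq
  obtain ⟨G, fG, -, -, HG⟩ := hd.2 p q hpq
  refine ⟨A ∪ B ∪ C ∪ E ∪ G, (((fA.union fB).union fC).union fE).union fG,
    by simp [xA], by simp [yC], fun f hf => ?_⟩
  have hD : algebraMap ℝ F (d ^ 2) ≠ 0 := by simpa using hd.1.ne'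
  refine eq_or_phi2_eq_of_equilateral hD (HA f ?_) (HB f ?_) (HC f ?_) (HE f ?_) (HG f ?_) <;>
  exact fun u hu v hv => hf u (by simp [hu]) v (by simp [hv])

/-- If `d ∈ D₂(F)` then `√3 · d ∈ D₂(F)`. -/
theorem stmt8 (F : Type*) [Field F] [Algebra ℝ F] (d : ℝ) (hd : d ∈ D2 F) :
    Real.sqrt 3 * d ∈ D2 F := by
  have : CharZero F := charZero_of_injective_algebraMap (algebraMap ℝ F).injective
  refine ⟨mul_pos (by positivity) hd.1, fun x y h => ?_⟩
  obtain ⟨z, hxz, hyz⟩ := exists_isosceles hd.1.le h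
  obtain ⟨A, fA, xA, yA, HA⟩ := exists_finite_eq_or_phi2_eq hd h
  obtain ⟨B, fB, -, -, HB⟩ := exists_finite_eq_or_phi2_eq hd hxz
  obtain ⟨C, fC, -, -, HC⟩ := hd.2 y z hyz
  refine ⟨A ∪ B ∪ C, (fA.union fB).union fC, by simp [xA], by simp [yA], fun f hf => ?_⟩
  have hD : algebraMap ℝ F (d ^ 2) ≠ 0 := by simpa using hd.1.ne'
  have hA := HA f fun u hu v hv => hf u (by simp [hu]) v (by simp [hv])
  have hB := HB f fun u hu v hv => hf u (by simp [hu]) v (by simp [hv])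
  have hC := HC f fun u hu v hv => hf u (by simp [hu]) v (by simp [hv])
  rcases hA with hA | hA
  · exfalso
    rw [← hA] at hC
    rcases hB with hB | hB
    · rw [← hB] at hC
      exact hD (by rw [← hC]; simp [phi2])
    · have : (2 : F) * algebraMap ℝ F (d ^ 2) = 0 := by linear_combination hC - hB
      exact hD (by simpa using this)
  · rw [hA, mul_pow, Real.sq_sqrt (by norm_num), map_mul, map_ofNat]
end

section
/- Let F be a field that is an algebra over ℝ. If a, b ∈ D₂(F) and a > b, then √(a² − b²) ∈ D₂(F). -/
open Filter

section PhiAlgebra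

variable {F : Type*} [Field F]

lemma eq_zero_of_orthogonal_of_cross_ne_zero {r₀ r₁ s₀ s₁ u₀ u₁ : F}
    (hr : r₀ * u₀ + r₁ * u₁ = 0) (hs : s₀ * u₀ + s₁ * u₁ = 0) (h : r₀ * s₁ - r₁ * s₀ ≠ 0) :
    u₀ = 0 ∧ u₁ = 0 := by
  constructor
  · refine (mul_eq_zero.mp ?_).resolve_left h
    linear_combination s₁ * hr - r₁ * hs
  · refine (mul_eq_zero.mp ?_).resolve_left h
    linear_combination r₀ * hs - s₀ * hr

lemma fin_two_eq_of_sub_eq_zero {X Y : Fin 2 → F} (h₀ : X 0 - Y 0 = 0) (h₁ : X 1 - Y 1 = 0) :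
    X = Y := by
  ext i
  fin_cases i
  · exact sub_eq_zero.mp h₀
  · exact sub_eq_zero.mp h₁

lemma phi2_self (X : Fin 2 → F) : phi2 F X X = 0 := by simp [phi2]

variable [CharZero F]

/-- Two apexes of equilateral triangles on a common side either coincide or are opposite. -/
lemma eq_or_phi2_eq_of_rhombus {D : F} (hD : D ≠ 0) {X Y P Q : Fin 2 → F}
    (hPQ : phi2 F P Q = D) (hXP : phi2 F X P = D) (hXQ : phi2 F X Q = D)
    (hYP : phi2 F Y P = D) (hYQ : phi2 F Y Q = D) :
    X = Y ∨ phi2 F X Y = 3 * D := by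
  unfold phi2 at *
  by_cases hc : (Q 0 - P 0) * (X 1 + Y 1 - 2 * P 1) - (Q 1 - P 1) * (X 0 + Y 0 - 2 * P 0) = 0
  · right
    obtain ⟨h₀, h₁⟩ := eq_zero_of_orthogonal_of_cross_ne_zero
      (r₀ := Q 0 - P 0) (r₁ := Q 1 - P 1) (s₀ := -(Q 1 - P 1)) (s₁ := Q 0 - P 0)
      (u₀ := X 0 + Y 0 - P 0 - Q 0) (u₁ := X 1 + Y 1 - P 1 - Q 1)
      (by linear_combination (hXP - hXQ + hYP - hYQ) / 2)
      (by linear_combination hc)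
      (by
        intro h
        apply hD
        linear_combination h - hPQ)
    linear_combination 2 * hXP + 2 * hYP - hPQ
      - (X 0 + Y 0 - 3 * P 0 + Q 0) * h₀ - (X 1 + Y 1 - 3 * P 1 + Q 1) * h₁
  · left
    obtain ⟨h₀, h₁⟩ := eq_zero_of_orthogonal_of_cross_ne_zero
      (u₀ := X 0 - Y 0) (u₁ := X 1 - Y 1)
      (by linear_combination (hXP - hXQ - hYP + hYQ) / 2)
      (by linear_combination hXP - hYP) hc
    exact fin_two_eq_of_sub_eq_zero h₀ h₁

/-- In a strip of three equilateral triangles, the two collinear outer sides span twice a side. -/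
lemma phi2_eq_four_mul_of_triangle_strip {D : F} (hD : D ≠ 0) {X Y M R S : Fin 2 → F}
    (hXM : phi2 F X M = D) (hYM : phi2 F Y M = D) (hRM : phi2 F R M = D) (hSM : phi2 F S M = D)
    (hRS : phi2 F R S = D) (hXR : phi2 F X R = D) (hYS : phi2 F Y S = D)
    (hXS : phi2 F X S = 3 * D) (hYR : phi2 F Y R = 3 * D) :
    phi2 F X Y = 4 * D := by
  unfold phi2 at *
  obtain ⟨h₀, h₁⟩ := eq_zero_of_orthogonal_of_cross_ne_zero
    (r₀ := R 0 - M 0) (r₁ := R 1 - M 1) (s₀ := S 0 - M 0) (s₁ := S 1 - M 1)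
    (u₀ := X 0 + Y 0 - 2 * M 0) (u₁ := X 1 + Y 1 - 2 * M 1)
    (by linear_combination (hXM + hRM - hXR + hYM + hRM - hYR) / 2)
    (by linear_combination (hXM + hSM - hXS + hYM + hSM - hYS) / 2)
    (by
      intro h
      have hip : (R 0 - M 0) * (S 0 - M 0) + (R 1 - M 1) * (S 1 - M 1) = D / 2 := by
        linear_combination (hRM + hSM - hRS) / 2
      have h3 : D * D = 0 := by
        set a := R 0 - M 0
        set b := R 1 - M 1
        set c := S 0 - M 0
        set e := S 1 - M 1
        linear_combination (4 / 3) * ((a * e - b * c) * h - (c ^ 2 + e ^ 2) * hRM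
          - D * hSM + (a * c + b * e + D / 2) * hip)
      exact hD (mul_self_eq_zero.mp h3))
  linear_combination 2 * hXM + 2 * hYM
    - (X 0 + Y 0 - 2 * M 0) * h₀ - (X 1 + Y 1 - 2 * M 1) * h₁

/-- The median to the base of an isosceles triangle, given the leg and half of the base. -/
lemma phi2_median_eq_sub {A B : F} (hB : B ≠ 0) {X Y P Q : Fin 2 → F}
    (hXP : phi2 F X P = A) (hXQ : phi2 F X Q = A) (hYP : phi2 F Y P = B) (hYQ : phi2 F Y Q = B)
    (hPQ : phi2 F P Q = 4 * B) :
    phi2 F X Y = A - B := by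
  unfold phi2 at *
  obtain ⟨h₀, h₁⟩ : P 0 + Q 0 - 2 * Y 0 = 0 ∧ P 1 + Q 1 - 2 * Y 1 = 0 := by
    have hip : (P 0 - Y 0) * (Q 0 - Y 0) + (P 1 - Y 1) * (Q 1 - Y 1) = -B := by
      linear_combination (hYP + hYQ - hPQ) / 2
    have hsq : ((P 0 - Y 0) * (Q 1 - Y 1) - (P 1 - Y 1) * (Q 0 - Y 0)) ^ 2 = 0 := by
      linear_combination ((Y 0 - Q 0) ^ 2 + (Y 1 - Q 1) ^ 2) * hYP + B * hYQ
        - ((P 0 - Y 0) * (Q 0 - Y 0) + (P 1 - Y 1) * (Q 1 - Y 1) - B) * hip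
    have hcr := pow_eq_zero_iff (two_ne_zero) |>.mp hsq
    exact eq_zero_of_orthogonal_of_cross_ne_zero
      (r₀ := P 0 - Y 0) (r₁ := P 1 - Y 1) (s₀ := -(P 1 - Y 1)) (s₁ := P 0 - Y 0)
      (by linear_combination hYP + hip)
      (by linear_combination hcr)
      (by
        intro h
        apply hB
        linear_combination h - hYP)
  linear_combination (hXP + hXQ) / 2 - (hYP + hYQ) / 2
    + (X 0 - Y 0) * h₀ + (X 1 - Y 1) * h₁

end PhiAlgebra

section Frame

/-- The point with coordinates `(α, β)` in the orthogonal frame with origin `x` and first unit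
point `y`. -/
noncomputable def framePoint (x y : EuclideanSpace ℝ (Fin 2)) (α β : ℝ) :
    EuclideanSpace ℝ (Fin 2) :=
  !₂[x 0 + α * (y 0 - x 0) - β * (y 1 - x 1), x 1 + α * (y 1 - x 1) + β * (y 0 - x 0)]

lemma framePoint_zero_zero (x y : EuclideanSpace ℝ (Fin 2)) : framePoint x y 0 0 = x := by
  ext i
  fin_cases i <;> simp [framePoint]

lemma framePoint_one_zero (x y : EuclideanSpace ℝ (Fin 2)) : framePoint x y 1 0 = y := by
  ext i
  fin_cases i <;> simp [framePoint]

lemma dist_framePoint {x y : EuclideanSpace ℝ (Fin 2)} {c d α β γ δ : ℝ} (hxy : dist x y = c)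
    (hd : 0 ≤ d) (h : ((α - γ) ^ 2 + (β - δ) ^ 2) * c ^ 2 = d ^ 2) :
    dist (framePoint x y α β) (framePoint x y γ δ) = d := by
  have hc : c ^ 2 = (x 0 - y 0) ^ 2 + (x 1 - y 1) ^ 2 := by
    rw [← hxy, EuclideanSpace.dist_eq, Real.sq_sqrt (by positivity)]
    simp [Real.dist_eq, sq_abs]
  rw [EuclideanSpace.dist_eq, Real.sqrt_eq_iff_mul_self_eq (by positivity) hd]
  simp only [framePoint, Fin.sum_univ_two, Real.dist_eq, sq_abs, PiLp.toLp_apply,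
    Matrix.cons_val_zero, Matrix.cons_val_one]
  rw [hc] at h
  linear_combination h

end Frame

section Forcing

variable {F : Type*} [Field F]

/-- `f` preserves unit distance on `S`. -/
def PreservesUnitOn (S : Finset (EuclideanSpace ℝ (Fin 2)))
    (f : EuclideanSpace ℝ (Fin 2) → (Fin 2 → F)) : Prop :=
  ∀ u ∈ S, ∀ v ∈ S, dist u v = 1 → phi2 F (f u) (f v) = 1

variable [Algebra ℝ F]

lemma mem_D2_iff {d : ℝ} : d ∈ D2 F ↔ 0 < d ∧ ∀ x y : EuclideanSpace ℝ (Fin 2), dist x y = d →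
    ∀ᶠ S : Finset (EuclideanSpace ℝ (Fin 2)) in atTop,
      ∀ f : EuclideanSpace ℝ (Fin 2) → (Fin 2 → F), PreservesUnitOn S f →
        phi2 F (f x) (f y) = algebraMap ℝ F (d ^ 2) := by
  classical
  refine and_congr_right fun _ => forall₃_congr fun x y _ => ?_
  rw [eventually_atTop]
  constructor
  · rintro ⟨S, hS, -, -, h⟩
    refine ⟨hS.toFinset, fun T hT f hf => h f fun u hu v hv => hf u ?_ v ?_⟩
    · exact hT (hS.mem_toFinset.mpr hu)
    · exact hT (hS.mem_toFinset.mpr hv)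
  · rintro ⟨S, h⟩
    refine ⟨↑(S ∪ {x, y}), Finset.finite_toSet _, by simp, by simp, fun f hf => ?_⟩
    exact h (S ∪ {x, y}) Finset.subset_union_left f fun u hu v hv => hf u hu v hv

lemma eventually_phi2_framePoint {x y : EuclideanSpace ℝ (Fin 2)} {c d α β γ δ : ℝ}
    (hd : d ∈ D2 F) (hxy : dist x y = c)
    (h : ((α - γ) ^ 2 + (β - δ) ^ 2) * c ^ 2 = d ^ 2) :
    ∀ᶠ S : Finset (EuclideanSpace ℝ (Fin 2)) in atTop,
      ∀ f : EuclideanSpace ℝ (Fin 2) → (Fin 2 → F), PreservesUnitOn S f →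
        phi2 F (f (framePoint x y α β)) (f (framePoint x y γ δ)) = algebraMap ℝ F (d ^ 2) := by
  rw [mem_D2_iff] at hd
  exact hd.2 _ _ (dist_framePoint hxy hd.1.le h)

lemma algebraMap_sq_ne_zero {d : ℝ} (hd : 0 < d) : algebraMap ℝ F (d ^ 2) ≠ 0 := by
  rw [map_ne_zero]
  positivity

lemma eventually_eq_or_phi2_eq {d : ℝ} (hd : d ∈ D2 F) {x y : EuclideanSpace ℝ (Fin 2)}
    (hxy : dist x y = √3 * d) :
    ∀ᶠ S : Finset (EuclideanSpace ℝ (Fin 2)) in atTop,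
      ∀ f : EuclideanSpace ℝ (Fin 2) → (Fin 2 → F), PreservesUnitOn S f →
        f x = f y ∨ phi2 F (f x) (f y) = 3 * algebraMap ℝ F (d ^ 2) := by
  have : CharZero F := charZero_of_injective_algebraMap (algebraMap ℝ F).injective
  have h3 : √3 ^ 2 = (3 : ℝ) := Real.sq_sqrt (by norm_num)
  have hc : (√3 * d) ^ 2 = 3 * d ^ 2 := by rw [mul_pow, h3]
  filter_upwards [
    eventually_phi2_framePoint (α := 1 / 2) (β := √3 / 6) (γ := 1 / 2) (δ := -√3 / 6) hd hxy
      (by rw [hc]; linear_combination d ^ 2 / 3 * h3),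
    eventually_phi2_framePoint (α := 0) (β := 0) (γ := 1 / 2) (δ := √3 / 6) hd hxy
      (by rw [hc]; linear_combination d ^ 2 / 12 * h3),
    eventually_phi2_framePoint (α := 0) (β := 0) (γ := 1 / 2) (δ := -√3 / 6) hd hxy
      (by rw [hc]; linear_combination d ^ 2 / 12 * h3),
    eventually_phi2_framePoint (α := 1) (β := 0) (γ := 1 / 2) (δ := √3 / 6) hd hxy
      (by rw [hc]; linear_combination d ^ 2 / 12 * h3),
    eventually_phi2_framePoint (α := 1) (β := 0) (γ := 1 / 2) (δ := -√3 / 6) hd hxy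
      (by rw [hc]; linear_combination d ^ 2 / 12 * h3)] with S h₁ h₂ h₃ h₄ h₅ f hf
  have := eq_or_phi2_eq_of_rhombus (algebraMap_sq_ne_zero hd.1)
    (h₁ f hf) (h₂ f hf) (h₃ f hf) (h₄ f hf) (h₅ f hf)
  rwa [framePoint_zero_zero, framePoint_one_zero] at this

theorem sqrt_three_mul_mem_D2 {d : ℝ} (hd : d ∈ D2 F) : √3 * d ∈ D2 F := by
  have : CharZero F := charZero_of_injective_algebraMap (algebraMap ℝ F).injective
  have hpos : 0 < d := hd.1
  have h3 : √3 ^ 2 = (3 : ℝ) := Real.sq_sqrt (by norm_num)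
  have h11 : √11 ^ 2 = (11 : ℝ) := Real.sq_sqrt (by norm_num)
  have hc : (√3 * d) ^ 2 = 3 * d ^ 2 := by rw [mul_pow, h3]
  refine mem_D2_iff.mpr ⟨by positivity, fun x y hxy => ?_⟩
  have hxz : dist x (framePoint x y (5 / 6) (√11 / 6)) = √3 * d := by
    nth_rewrite 1 [← framePoint_zero_zero x y]
    refine dist_framePoint hxy (by positivity) ?_
    linear_combination (√3 * d) ^ 2 / 36 * h11
  filter_upwards [eventually_eq_or_phi2_eq hd hxy, eventually_eq_or_phi2_eq hd hxz,
    eventually_phi2_framePoint (α := 1) (β := 0) (γ := 5 / 6) (δ := √11 / 6) hd hxy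
      (by rw [hc]; linear_combination d ^ 2 / 12 * h11)] with S h₁ h₂ h₃ f hf
  have hD := algebraMap_sq_ne_zero (F := F) hpos
  have hgoal : algebraMap ℝ F ((√3 * d) ^ 2) = 3 * algebraMap ℝ F (d ^ 2) := by
    rw [hc, map_mul, map_ofNat]
  rw [hgoal]
  refine (h₁ f hf).resolve_left fun hfxy => ?_
  have h₃' := h₃ f hf
  rw [framePoint_one_zero, ← hfxy] at h₃'
  rcases h₂ f hf with h | h
  · rw [← h, phi2_self] at h₃'
    exact hD h₃'.symm
  · rw [h] at h₃'
    apply hD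
    linear_combination h₃' / 2

theorem two_mul_mem_D2 {d : ℝ} (hd : d ∈ D2 F) : 2 * d ∈ D2 F := by
  have : CharZero F := charZero_of_injective_algebraMap (algebraMap ℝ F).injective
  have hpos : 0 < d := hd.1
  have h3 : √3 ^ 2 = (3 : ℝ) := Real.sq_sqrt (by norm_num)
  have hd3 := sqrt_three_mul_mem_D2 hd
  have hc : (√3 * d) ^ 2 = 3 * d ^ 2 := by rw [mul_pow, h3]
  have hgoal3 : algebraMap ℝ F ((√3 * d) ^ 2) = 3 * algebraMap ℝ F (d ^ 2) := by
    rw [hc, map_mul, map_ofNat]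
  have hgoal4 : algebraMap ℝ F ((2 * d) ^ 2) = 4 * algebraMap ℝ F (d ^ 2) := by
    rw [show (2 * d) ^ 2 = 4 * d ^ 2 by ring, map_mul, map_ofNat]
  refine mem_D2_iff.mpr ⟨by positivity, fun x y hxy => ?_⟩
  filter_upwards [
    eventually_phi2_framePoint (α := 0) (β := 0) (γ := 1 / 2) (δ := 0) hd hxy (by ring),
    eventually_phi2_framePoint (α := 1) (β := 0) (γ := 1 / 2) (δ := 0) hd hxy (by ring),
    eventually_phi2_framePoint (α := 1 / 4) (β := √3 / 4) (γ := 1 / 2) (δ := 0) hd hxy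
      (by linear_combination d ^ 2 / 4 * h3),
    eventually_phi2_framePoint (α := 3 / 4) (β := √3 / 4) (γ := 1 / 2) (δ := 0) hd hxy
      (by linear_combination d ^ 2 / 4 * h3),
    eventually_phi2_framePoint (α := 1 / 4) (β := √3 / 4) (γ := 3 / 4) (δ := √3 / 4) hd hxy
      (by ring),
    eventually_phi2_framePoint (α := 0) (β := 0) (γ := 1 / 4) (δ := √3 / 4) hd hxy
      (by linear_combination d ^ 2 / 4 * h3),
    eventually_phi2_framePoint (α := 1) (β := 0) (γ := 3 / 4) (δ := √3 / 4) hd hxy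
      (by linear_combination d ^ 2 / 4 * h3),
    eventually_phi2_framePoint (α := 0) (β := 0) (γ := 3 / 4) (δ := √3 / 4) hd3 hxy
      (by rw [hc]; linear_combination d ^ 2 / 4 * h3),
    eventually_phi2_framePoint (α := 1) (β := 0) (γ := 1 / 4) (δ := √3 / 4) hd3 hxy
      (by rw [hc]; linear_combination d ^ 2 / 4 * h3)]
    with S h₁ h₂ h₃ h₄ h₅ h₆ h₇ h₈ h₉ f hf
  have := phi2_eq_four_mul_of_triangle_strip (algebraMap_sq_ne_zero hpos)
    (h₁ f hf) (h₂ f hf) (h₃ f hf) (h₄ f hf) (h₅ f hf) (h₆ f hf) (h₇ f hf)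
    ((h₈ f hf).trans hgoal3) ((h₉ f hf).trans hgoal3)
  rwa [framePoint_zero_zero, framePoint_one_zero, ← hgoal4] at this

end Forcing

/-- If `a, b ∈ D₂(F)` and `a > b`, then `√(a² − b²) ∈ D₂(F)`. -/
theorem stmt10 (F : Type*) [Field F] [Algebra ℝ F] (a b : ℝ)
    (ha : a ∈ D2 F) (hb : b ∈ D2 F) (hab : a > b) :
    Real.sqrt (a ^ 2 - b ^ 2) ∈ D2 F := by
  have : CharZero F := charZero_of_injective_algebraMap (algebraMap ℝ F).injective
  have hb0 : 0 < b := hb.1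
  have hpos : 0 < a ^ 2 - b ^ 2 := by nlinarith
  have hb2 := two_mul_mem_D2 hb
  set c := Real.sqrt (a ^ 2 - b ^ 2)
  have hc0 : 0 < c := Real.sqrt_pos.mpr hpos
  have hc : c ^ 2 = a ^ 2 - b ^ 2 := Real.sq_sqrt hpos.le
  have hbc : b / c * c = b := div_mul_cancel₀ b hc0.ne'
  have hgoal4 : algebraMap ℝ F ((2 * b) ^ 2) = 4 * algebraMap ℝ F (b ^ 2) := by
    rw [show (2 * b) ^ 2 = 4 * b ^ 2 by ring, map_mul, map_ofNat]
  refine mem_D2_iff.mpr ⟨hc0, fun x y hxy => ?_⟩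
  filter_upwards [
    eventually_phi2_framePoint (α := 0) (β := 0) (γ := 1) (δ := b / c) ha hxy
      (by linear_combination hc + (b / c * c + b) * hbc),
    eventually_phi2_framePoint (α := 0) (β := 0) (γ := 1) (δ := -(b / c)) ha hxy
      (by linear_combination hc + (b / c * c + b) * hbc),
    eventually_phi2_framePoint (α := 1) (β := 0) (γ := 1) (δ := b / c) hb hxy
      (by linear_combination (b / c * c + b) * hbc),
    eventually_phi2_framePoint (α := 1) (β := 0) (γ := 1) (δ := -(b / c)) hb hxy
      (by linear_combination (b / c * c + b) * hbc),
    eventually_phi2_framePoint (α := 1) (β := b / c) (γ := 1) (δ := -(b / c)) hb2 hxy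
      (by linear_combination 4 * (b / c * c + b) * hbc)] with S h₁ h₂ h₃ h₄ h₅ f hf
  have := phi2_median_eq_sub (algebraMap_sq_ne_zero hb0)
    (h₁ f hf) (h₂ f hf) (h₃ f hf) (h₄ f hf) ((h₅ f hf).trans hgoal4)
  rwa [framePoint_zero_zero, framePoint_one_zero, ← map_sub, ← hc] at this
end

section
/- Let F be a field that is an algebra over ℝ. For every positive integer n, the distance n belongs to D₂(F). -/
/-- `P` holds for every map that preserves unit distance on some fixed finite set of points. -/
def FinitelyForced (F : Type*) [Field F]
    (P : (EuclideanSpace ℝ (Fin 2) → (Fin 2 → F)) → Prop) : Prop :=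
  ∃ S : Set (EuclideanSpace ℝ (Fin 2)), S.Finite ∧
    ∀ f : EuclideanSpace ℝ (Fin 2) → (Fin 2 → F),
      (∀ u ∈ S, ∀ v ∈ S, dist u v = 1 → phi2 F (f u) (f v) = 1) → P f

namespace FinitelyForced

variable {F : Type*} [Field F] {P Q : (EuclideanSpace ℝ (Fin 2) → (Fin 2 → F)) → Prop}

theorem mono (hP : FinitelyForced F P) (h : ∀ f, P f → Q f) : FinitelyForced F Q := by
  obtain ⟨S, hS, H⟩ := hP
  exact ⟨S, hS, fun f hf => h f (H f hf)⟩

theorem and (hP : FinitelyForced F P) (hQ : FinitelyForced F Q) :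
    FinitelyForced F fun f => P f ∧ Q f := by
  obtain ⟨S, hS, HS⟩ := hP
  obtain ⟨T, hT, HT⟩ := hQ
  exact ⟨S ∪ T, hS.union hT, fun f hf =>
    ⟨HS f fun u hu v hv => hf u (.inl hu) v (.inl hv),
      HT f fun u hu v hv => hf u (.inr hu) v (.inr hv)⟩⟩

theorem of_dist_eq_one {x y : EuclideanSpace ℝ (Fin 2)} (h : dist x y = 1) :
    FinitelyForced F fun f => phi2 F (f x) (f y) = 1 :=
  ⟨{x, y}, Set.toFinite _, fun f hf => hf x (by simp) y (by simp) h⟩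

end FinitelyForced

/-- Two equilateral triangles of side `1` in `F²` on a common side coincide or form a rhombus. -/
theorem eq_or_add_eq_add_of_phi2_eq_one {F : Type*} [Field F] [CharZero F] {p a b q : Fin 2 → F}
    (hpa : phi2 F p a = 1) (hpb : phi2 F p b = 1) (hab : phi2 F a b = 1)
    (hqa : phi2 F q a = 1) (hqb : phi2 F q b = 1) : p = q ∨ p + q = a + b := by
  simp only [phi2] at *
  obtain ⟨s0, hs0⟩ : ∃ s, s = a 0 - p 0 := ⟨_, rfl⟩
  obtain ⟨s1, hs1⟩ : ∃ s, s = a 1 - p 1 := ⟨_, rfl⟩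
  obtain ⟨t0, ht0⟩ : ∃ s, s = b 0 - p 0 := ⟨_, rfl⟩
  obtain ⟨t1, ht1⟩ : ∃ s, s = b 1 - p 1 := ⟨_, rfl⟩
  obtain ⟨r0, hr0⟩ : ∃ s, s = q 0 - p 0 := ⟨_, rfl⟩
  obtain ⟨r1, hr1⟩ : ∃ s, s = q 1 - p 1 := ⟨_, rfl⟩
  have hs : s0 ^ 2 + s1 ^ 2 = 1 := by rw [hs0, hs1, ← hpa]; ring
  have ht : t0 ^ 2 + t1 ^ 2 = 1 := by rw [ht0, ht1, ← hpb]; ring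
  have hd : (s0 - t0) ^ 2 + (s1 - t1) ^ 2 = 1 := by rw [hs0, hs1, ht0, ht1, ← hab]; ring
  have hrs : (r0 - s0) ^ 2 + (r1 - s1) ^ 2 = 1 := by rw [hs0, hs1, hr0, hr1, ← hqa]; ring
  have hrt : (r0 - t0) ^ 2 + (r1 - t1) ^ 2 = 1 := by rw [ht0, ht1, hr0, hr1, ← hqb]; ring
  have hr : r0 * (s0 - t0) + r1 * (s1 - t1) = 0 := by
    have : (2 : F) * (r0 * (s0 - t0) + r1 * (s1 - t1)) = 0 := by
      linear_combination hs - ht - hrs + hrt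
    simpa using this
  have he : (s0 + t0) ^ 2 + (s1 + t1) ^ 2 = 3 := by linear_combination 2 * hs + 2 * ht - hd
  have hk : r0 ^ 2 + r1 ^ 2 = r0 * (s0 + t0) + r1 * (s1 + t1) := by
    have : (2 : F) * (r0 ^ 2 + r1 ^ 2 - (r0 * (s0 + t0) + r1 * (s1 + t1))) = 0 := by
      linear_combination hrs + hrt - hs - ht
    have := (mul_eq_zero.mp this).resolve_left two_ne_zero
    linear_combination this
  have hdet : r0 * (s1 + t1) = r1 * (s0 + t0) := by
    have hed : (s0 + t0) * (s0 - t0) + (s1 + t1) * (s1 - t1) = 0 := by linear_combination hs - ht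
    linear_combination (-(r0 * (s1 + t1) - r1 * (s0 + t0))) * hd +
      ((s0 - t0) * (s1 + t1) - (s1 - t1) * (s0 + t0)) * hr -
      (r1 * (s0 - t0) - r0 * (s1 - t1)) * hed
  have h0 : 3 * r0 = (r0 ^ 2 + r1 ^ 2) * (s0 + t0) := by
    rw [hk]; linear_combination (-r0) * he + (s1 + t1) * hdet
  have h1 : 3 * r1 = (r0 ^ 2 + r1 ^ 2) * (s1 + t1) := by
    rw [hk]; linear_combination (-r1) * he - (s0 + t0) * hdet
  have h3 : (3 : F) ≠ 0 := three_ne_zero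
  have hk3 : (r0 ^ 2 + r1 ^ 2) * (r0 ^ 2 + r1 ^ 2 - 3) = 0 := by
    linear_combination (r0 ^ 2 + r1 ^ 2) * hk - r0 * h0 - r1 * h1
  rcases mul_eq_zero.mp hk3 with h | h
  · left
    rw [h, zero_mul] at h0 h1
    have h0 := (mul_eq_zero.mp h0).resolve_left h3
    have h1 := (mul_eq_zero.mp h1).resolve_left h3
    ext i; fin_cases i
    · change p 0 = q 0; linear_combination hr0 - h0
    · change p 1 = q 1; linear_combination hr1 - h1
  · right
    rw [sub_eq_zero.mp h] at h0 h1
    have h0 := mul_left_cancel₀ h3 h0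
    have h1 := mul_left_cancel₀ h3 h1
    ext i; fin_cases i
    · change p 0 + q 0 = a 0 + b 0; linear_combination h0 - hr0 + hs0 + ht0
    · change p 1 + q 1 = a 1 + b 1; linear_combination h1 - hr1 + hs1 + ht1

/-- The diagonal of the rhombus formed by two equilateral triangles of side `1` in `F²`. -/
theorem phi2_eq_three_of_add_eq_add {F : Type*} [Field F] {p a b q : Fin 2 → F}
    (hpa : phi2 F p a = 1) (hpb : phi2 F p b = 1) (hab : phi2 F a b = 1)
    (h : p + q = a + b) : phi2 F p q = 3 := by
  have h0 : q 0 = a 0 + b 0 - p 0 := eq_sub_of_add_eq' (congrFun h 0)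
  have h1 : q 1 = a 1 + b 1 - p 1 := eq_sub_of_add_eq' (congrFun h 1)
  simp only [phi2] at *
  rw [h0, h1]
  linear_combination 2 * hpa + 2 * hpb - hab

/-- The linear map of the plane with matrix `(c, -s; s, c)`. -/
noncomputable def planeRotation (c s : ℝ) (u : EuclideanSpace ℝ (Fin 2)) :
    EuclideanSpace ℝ (Fin 2) :=
  !₂[c * u 0 - s * u 1, s * u 0 + c * u 1]

theorem planeRotation_add (c s : ℝ) (u v : EuclideanSpace ℝ (Fin 2)) :
    planeRotation c s (u + v) = planeRotation c s u + planeRotation c s v := by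
  ext i; fin_cases i <;> simp [planeRotation] <;> ring

theorem planeRotation_sub (c s : ℝ) (u v : EuclideanSpace ℝ (Fin 2)) :
    planeRotation c s (u - v) = planeRotation c s u - planeRotation c s v := by
  ext i; fin_cases i <;> simp [planeRotation] <;> ring

theorem norm_planeRotation {c s : ℝ} (h : c ^ 2 + s ^ 2 = 1) (u : EuclideanSpace ℝ (Fin 2)) :
    ‖planeRotation c s u‖ = ‖u‖ := by
  rw [← sq_eq_sq₀ (norm_nonneg _) (norm_nonneg _), EuclideanSpace.real_norm_sq_eq,
    EuclideanSpace.real_norm_sq_eq]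
  simp [planeRotation, Fin.sum_univ_two]
  linear_combination (u 0 ^ 2 + u 1 ^ 2) * h

theorem norm_sub_planeRotation_sq {c s : ℝ} (h : c ^ 2 + s ^ 2 = 1)
    (u : EuclideanSpace ℝ (Fin 2)) :
    ‖u - planeRotation c s u‖ ^ 2 = (2 - 2 * c) * ‖u‖ ^ 2 := by
  rw [EuclideanSpace.real_norm_sq_eq, EuclideanSpace.real_norm_sq_eq]
  simp [planeRotation, Fin.sum_univ_two]
  linear_combination (u 0 ^ 2 + u 1 ^ 2) * h

namespace FinitelyForced

variable {F : Type*} [Field F]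

/-- The unit distances in a rhombus of side `1` with a short diagonal of length `1`. -/
theorem rhombus_sides {p u v : EuclideanSpace ℝ (Fin 2)} (hu : ‖u‖ = 1) (hv : ‖v‖ = 1)
    (huv : ‖u - v‖ = 1) :
    FinitelyForced F fun f => phi2 F (f p) (f (p + u)) = 1 ∧ phi2 F (f p) (f (p + v)) = 1 ∧
      phi2 F (f (p + u)) (f (p + v)) = 1 ∧ phi2 F (f (p + (u + v))) (f (p + u)) = 1 ∧
      phi2 F (f (p + (u + v))) (f (p + v)) = 1 := by
  refine .and (.of_dist_eq_one ?_) (.and (.of_dist_eq_one ?_) (.and (.of_dist_eq_one ?_)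
    (.and (.of_dist_eq_one ?_) (.of_dist_eq_one ?_)))) <;> simp [dist_eq_norm, hu, hv, huv]

theorem rhombus [CharZero F] (p : EuclideanSpace ℝ (Fin 2)) {u v : EuclideanSpace ℝ (Fin 2)}
    (hu : ‖u‖ = 1) (hv : ‖v‖ = 1) (huv : ‖u - v‖ = 1) :
    FinitelyForced F fun f => f p + f (p + (u + v)) = f (p + u) + f (p + v) := by
  have hcs : (5 / 6 : ℝ) ^ 2 + (√11 / 6) ^ 2 = 1 := by
    rw [div_pow √11, Real.sq_sqrt (by norm_num)]; norm_num
  set T := planeRotation (5 / 6) (√11 / 6) with hT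
  have hw : ‖u + v‖ ^ 2 = 3 := by
    have := parallelogram_law_with_norm ℝ u v
    rw [hu, hv, huv] at this
    linear_combination this
  have hdist : dist (p + (u + v)) (p + (T u + T v)) = 1 := by
    rw [hT, ← planeRotation_add, dist_add_left, dist_eq_norm,
      ← sq_eq_sq₀ (norm_nonneg _) zero_le_one, norm_sub_planeRotation_sq hcs, hw]
    norm_num
  have hTu : ‖T u‖ = 1 := by rw [hT, norm_planeRotation hcs, hu]
  have hTv : ‖T v‖ = 1 := by rw [hT, norm_planeRotation hcs, hv]
  have hTuv : ‖T u - T v‖ = 1 := by rw [hT, ← planeRotation_sub, norm_planeRotation hcs, huv]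
  refine ((rhombus_sides (p := p) hu hv huv).and ((rhombus_sides (p := p) hTu hTv hTuv).and
    (of_dist_eq_one hdist))).mono ?_
  rintro f ⟨⟨h1, h2, h3, h4, h5⟩, ⟨g1, g2, g3, g4, g5⟩, h⟩
  refine (eq_or_add_eq_add_of_phi2_eq_one h1 h2 h3 h4 h5).resolve_left fun hp => ?_
  rw [← hp] at h
  rcases eq_or_add_eq_add_of_phi2_eq_one g1 g2 g3 g4 g5 with hq | hq
  · rw [← hq] at h
    simp [phi2] at h
  · rw [phi2_eq_three_of_add_eq_add g1 g2 g3 hq] at h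
    norm_num at h

theorem exists_norm_sub_eq_one {u : EuclideanSpace ℝ (Fin 2)} (hu : ‖u‖ = 1) :
    ∃ v : EuclideanSpace ℝ (Fin 2), ‖v‖ = 1 ∧ ‖u - v‖ = 1 := by
  have hcs : (1 / 2 : ℝ) ^ 2 + (√3 / 2) ^ 2 = 1 := by
    rw [div_pow √3, Real.sq_sqrt (by norm_num)]; norm_num
  refine ⟨planeRotation (1 / 2) (√3 / 2) u, by rw [norm_planeRotation hcs, hu], ?_⟩
  rw [← sq_eq_sq₀ (norm_nonneg _) zero_le_one, norm_sub_planeRotation_sq hcs, hu]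
  norm_num

theorem collinear_step [CharZero F] (p : EuclideanSpace ℝ (Fin 2))
    {u : EuclideanSpace ℝ (Fin 2)} (hu : ‖u‖ = 1) :
    FinitelyForced F fun f => f (p + u + u) - f (p + u) = f (p + u) - f p := by
  obtain ⟨v, hv, huv⟩ := exists_norm_sub_eq_one hu
  refine ((rhombus p hu hv huv).and
    (rhombus (p + v) (u := u) (v := u - v) hu huv (by simpa using hv))).mono ?_
  rintro f ⟨h1, h2⟩
  rw [show p + v + (u + (u - v)) = p + u + u by abel, show p + v + u = p + (u + v) by abel,
    show p + v + (u - v) = p + u by abel] at h2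
  linear_combination h1 + h2

theorem collinear [CharZero F] {u : EuclideanSpace ℝ (Fin 2)} (hu : ‖u‖ = 1) (n : ℕ)
    (p : EuclideanSpace ℝ (Fin 2)) :
    FinitelyForced F fun f => f (p + (n : ℝ) • u) - f p = (n : F) • (f (p + u) - f p) := by
  induction n generalizing p with
  | zero => exact ⟨∅, Set.finite_empty, fun f _ => by simp⟩
  | succ n ih =>
    refine ((ih (p + u)).and (collinear_step p hu)).mono ?_
    rintro f ⟨h1, h2⟩
    rw [h2] at h1
    rw [show p + ((n + 1 : ℕ) : ℝ) • u = p + u + (n : ℝ) • u by push_cast; module,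
      ← sub_add_sub_cancel _ (f (p + u)), h1]
    push_cast
    module

end FinitelyForced

/-- For every positive integer `n`, the distance `n` belongs to `D₂(F)`. -/
theorem stmt12 (F : Type*) [Field F] [Algebra ℝ F] (n : ℕ) (hn : 0 < n) :
    (n : ℝ) ∈ D2 F := by
  have : CharZero F := charZero_of_injective_algebraMap (algebraMap ℝ F).injective
  have hn0 : (n : ℝ) ≠ 0 := by positivity
  refine ⟨by positivity, fun x y hxy => ?_⟩
  set u : EuclideanSpace ℝ (Fin 2) := (n : ℝ)⁻¹ • (y - x) with hu_def
  have hu : ‖u‖ = 1 := by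
    rw [hu_def, norm_smul, ← dist_eq_norm, dist_comm, hxy]
    simp [hn0]
  have hy : x + (n : ℝ) • u = y := by rw [hu_def, smul_inv_smul₀ hn0]; abel
  obtain ⟨S, hS, H⟩ := (FinitelyForced.collinear (F := F) hu n x).and
    (.of_dist_eq_one (x := x) (y := x + u) (by simp [hu]))
  refine ⟨insert x (insert y S), (hS.insert y).insert x, by simp, by simp, fun f hf => ?_⟩
  obtain ⟨h, h1⟩ := H f fun a ha b hb => hf a (by simp [ha]) b (by simp [hb])
  rw [hy] at h
  have e0 : f y 0 - f x 0 = n * (f (x + u) 0 - f x 0) := congrFun h 0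
  have e1 : f y 1 - f x 1 = n * (f (x + u) 1 - f x 1) := congrFun h 1
  simp only [phi2] at *
  rw [← neg_sub (f y 0), ← neg_sub (f y 1), e0, e1, map_pow, map_natCast]
  linear_combination (n : F) ^ 2 * h1
end

section
/- If X, Y ∈ ℂ² and ψ₂(X,Y) is not a rational number, then there exists a map f : ℂ² → ℂ² such that ψ₂(f(S),f(T)) = ψ₂(S,T) for all S,T ∈ ℂ² with ψ₂(S,T) rational, but ψ₂(f(X),f(Y)) ≠ ψ₂(X,Y). -/
/-- `ψ₂((x₁,x₂),(y₁,y₂)) = (x₁−y₁)² + (x₂−y₂)²` on `ℂ²`. -/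
noncomputable def psi2 (x y : Fin 2 → ℂ) : ℂ := (x 0 - y 0) ^ 2 + (x 1 - y 1) ^ 2

open Polynomial in
/-- A transcendental element is not a rational function of its square. -/
theorem Transcendental.notMem_adjoin_sq {K L : Type*} [Field K] [Field L] [Algebra K L] {c : L}
    (hc : Transcendental K c) : c ∉ IntermediateField.adjoin K {c ^ 2} := by
  rw [IntermediateField.mem_adjoin_simple_iff]
  rintro ⟨r, s, h⟩
  have hc0 : c ≠ 0 := by
    rintro rfl
    exact hc isAlgebraic_zero
  have hs : Polynomial.aeval (c ^ 2) s ≠ 0 := by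
    intro h0
    rw [h0, div_zero] at h
    exact hc0 h
  have hpoly : expand K 2 s * X = expand K 2 r := by
    apply transcendental_iff_injective.mp hc
    rw [map_mul, expand_aeval, expand_aeval, aeval_X, mul_comm]
    exact (eq_div_iff hs).mp h
  apply hs
  suffices s = 0 by simp [this]
  ext n
  have := congrArg (fun p : K[X] => p.coeff (n * 2 + 1)) hpoly
  simp only [coeff_mul_X, coeff_expand_mul two_pos] at this
  rw [this, coeff_expand two_pos, if_neg (by omega), coeff_zero]

/-- A field is algebraically closed in its simple transcendental extensions. -/
theorem Transcendental.transcendental_of_mem_adjoin {K L : Type*} [Field K] [Field L] [Algebra K L]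
    {t c : L} (ht : Transcendental K t) (hct : c ∈ IntermediateField.adjoin K {t})
    (hc : c ∉ (algebraMap K L).range) : Transcendental K c := by
  obtain ⟨f, hf⟩ := (RatFunc.algEquivOfTranscendental t ht).surjective ⟨c, hct⟩
  have hfC : ¬∃ a, f = RatFunc.C a := by
    rintro ⟨a, rfl⟩
    refine hc ⟨a, ?_⟩
    rw [← RatFunc.algebraMap_eq_C, AlgEquiv.commutes] at hf
    exact congrArg Subtype.val hf
  have hinj : Function.Injective ((IntermediateField.adjoin K {t}).val.comp
      (RatFunc.algEquivOfTranscendental t ht).toAlgHom) := RingHom.injective _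
  have := (isAlgebraic_algHom_iff _ hinj).not.mpr (f.transcendental_of_ne_C hfC)
  have hcf : ((IntermediateField.adjoin K {t}).val.comp
      (RatFunc.algEquivOfTranscendental t ht).toAlgHom) f = c := congrArg Subtype.val hf
  rwa [hcf] at this

/-- A field is algebraic over every subfield that is maximal among those avoiding a fixed element. -/
theorem Subfield.isAlgebraic_of_maximal_notMem {L : Type*} [Field L] {c : L} {K : Subfield L}
    (hK : Maximal (fun F : Subfield L => c ∉ F) K) : Algebra.IsAlgebraic K L := by
  have hmem : ∀ u : L, Transcendental K u → c ∈ IntermediateField.adjoin K {u} := by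
    intro u hu
    by_contra hcu
    have hle : K ≤ (IntermediateField.adjoin K {u}).toSubfield := fun x hx =>
      (IntermediateField.adjoin K {u}).algebraMap_mem ⟨x, hx⟩
    have huK : u ∈ K := hK.le_of_ge hcu hle (IntermediateField.mem_adjoin_simple_self K u)
    exact hu (isAlgebraic_algebraMap (⟨u, huK⟩ : K))
  refine ⟨fun t => ?_⟩
  by_contra ht
  have hc : Transcendental K c := Transcendental.transcendental_of_mem_adjoin ht (hmem t ht) (by
    rintro ⟨x, rfl⟩
    exact hK.prop x.2)
  exact hc.notMem_adjoin_sq (hmem _ (hc.pow two_pos))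

/-- A subfield avoiding an element is contained in a subfield that is maximal among those avoiding
it. -/
theorem Subfield.exists_maximal_notMem {L : Type*} [Field L] {c : L} {F : Subfield L}
    (hc : c ∉ F) : ∃ K : Subfield L, F ≤ K ∧ Maximal (fun K : Subfield L => c ∉ K) K := by
  exact zorn_le_nonempty₀ {K : Subfield L | c ∉ K} (fun S hS hchain y hy =>
    ⟨sSup S, fun hmem => by
      obtain ⟨K, hKS, hcK⟩ := (Subfield.mem_sSup_of_directedOn ⟨y, hy⟩ hchain.directedOn).mp hmem
      exact hS hKS hcK, fun K hK => le_sSup hK⟩) F hc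

/-- In an algebraically closed field of characteristic zero, every element that is not rational is
moved by some automorphism. -/
theorem IsAlgClosed.exists_ringEquiv_apply_ne {L : Type*} [Field L] [CharZero L] [IsAlgClosed L]
    {c : L} (hc : ¬∃ q : ℚ, (q : L) = c) : ∃ σ : L ≃+* L, σ c ≠ c := by
  have hbot : c ∉ (algebraMap ℚ L).fieldRange := by
    rintro ⟨q, hq⟩
    exact hc ⟨q, by simpa using hq⟩
  obtain ⟨K, -, hK⟩ := Subfield.exists_maximal_notMem hbot
  have := Subfield.isAlgebraic_of_maximal_notMem hK
  have : IsAlgClosure K L := ⟨inferInstance, inferInstance⟩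
  have : IsGalois K L := {}
  by_contra! hfix
  obtain ⟨x, rfl⟩ := (InfiniteGalois.mem_range_algebraMap_iff_fixed (k := K) c).mpr
    fun f => hfix f.toRingEquiv
  exact hK.prop x.2

/-- If `X, Y ∈ ℂ²` and `ψ₂(X,Y)` is not rational, then there is a map
`f : ℂ² → ℂ²` such that `ψ₂(f(S),f(T)) = ψ₂(S,T)` for all `S, T ∈ ℂ²` with
`ψ₂(S,T)` rational, but `ψ₂(f(X),f(Y)) ≠ ψ₂(X,Y)`. -/
theorem stmt18 (X Y : Fin 2 → ℂ) (h : ¬ ∃ q : ℚ, (q : ℂ) = psi2 X Y) :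
    ∃ f : (Fin 2 → ℂ) → (Fin 2 → ℂ),
      (∀ S T : Fin 2 → ℂ, (∃ q : ℚ, (q : ℂ) = psi2 S T) → psi2 (f S) (f T) = psi2 S T) ∧
      psi2 (f X) (f Y) ≠ psi2 X Y := by
  obtain ⟨σ, hσ⟩ := IsAlgClosed.exists_ringEquiv_apply_ne h
  have hpsi : ∀ S T : Fin 2 → ℂ, psi2 (σ ∘ S) (σ ∘ T) = σ (psi2 S T) := by
    intro S T
    simp [psi2]
  refine ⟨fun S => σ ∘ S, ?_, by rwa [hpsi]⟩
  rintro S T ⟨q, hq⟩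
  rw [hpsi, ← hq, map_ratCast]
end

section
/- Let F be a field that is an algebra over ℝ and let n ≥ 1. For points c₁ = (z_{1,1},...,z_{1,n}), ..., c_{n+1} = (z_{n+1,1},...,z_{n+1,n}) ∈ Fⁿ, the square of the determinant of the (n+1)×(n+1) matrix whose i-th row is (z_{i,1}, ..., z_{i,n}, 1) equals ((−1)^{n+1}/2ⁿ) · Δ(c₁,...,c_{n+1}). -/
/-- The matrix whose `i`-th row is the point `c i` followed by `1`. -/
def affineMatrix {R : Type*} [One R] {n m : ℕ} (c : Fin m → Fin n → R) :
    Matrix (Fin m) (Fin (n + 1)) R :=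
  Matrix.of fun i j => if h : (j : ℕ) < n then c i ⟨(j : ℕ), h⟩ else 1

@[simp]
lemma affineMatrix_castSucc {R : Type*} [One R] {n m : ℕ} (c : Fin m → Fin n → R)
    (i : Fin m) (k : Fin n) : affineMatrix c i k.castSucc = c i k := by
  simp [affineMatrix]

@[simp]
lemma affineMatrix_last {R : Type*} [One R] {n m : ℕ} (c : Fin m → Fin n → R)
    (i : Fin m) : affineMatrix c i (Fin.last n) = 1 := by
  simp [affineMatrix]

/-- The matrix with first row `(1, 0, …, 0)` and further rows `(∑ k, (c i k) ^ 2, c i, 1)`. -/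
def paraboloidMatrix {R : Type*} [CommRing R] {n m : ℕ} (c : Fin m → Fin n → R) :
    Matrix (Fin (m + 1)) (Fin (n + 2)) R :=
  Matrix.of (Fin.cons (Fin.cons 1 0) fun i => Fin.cons (∑ k, c i k ^ 2) (affineMatrix c i))

lemma det_paraboloidMatrix {R : Type*} [CommRing R] {n : ℕ} (c : Fin (n + 1) → Fin n → R) :
    (paraboloidMatrix c).det = (affineMatrix c).det := by
  rw [Matrix.det_succ_row_zero, Fin.sum_univ_succ]
  simp [paraboloidMatrix]
  rfl

/-- The diagonal matrix with entries `1, -2, …, -2, 1`. -/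
def polarDiagonal (R : Type*) [CommRing R] (n : ℕ) : Fin (n + 2) → R :=
  Fin.cons 1 (Fin.snoc (fun _ : Fin n => -2) 1)

lemma cayleyMenger_eq_det_mul (F : Type*) [Field F] {n m : ℕ} (c : Fin m → Fin n → F) :
    cayleyMenger F n m c =
      (paraboloidMatrix c * Matrix.diagonal (polarDiagonal F n) *
        (paraboloidMatrix c).transpose.submatrix (Equiv.swap 0 (Fin.last (n + 1))) id).det := by
  have hmid (k : Fin n) :
      Equiv.swap 0 (Fin.last (n + 1)) k.castSucc.succ = k.castSucc.succ := by
    apply Equiv.swap_apply_of_ne_of_ne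
    · exact Fin.succ_ne_zero _
    · rw [← Fin.succ_last]
      exact fun h => (Fin.castSucc_lt_last k).ne (Fin.succ_injective _ h)
  unfold cayleyMenger
  congr 1
  ext i j
  rw [Matrix.mul_apply, Fin.sum_univ_succ, Fin.sum_univ_castSucc]
  simp only [Matrix.mul_diagonal, Matrix.submatrix_apply, Matrix.transpose_apply, hmid,
    Fin.succ_last, Equiv.swap_apply_left, Equiv.swap_apply_right, id]
  rw [← Fin.succ_last]
  cases i using Fin.cases <;> cases j using Fin.cases <;>
    simp [paraboloidMatrix, polarDiagonal, phi]
  simp only [sub_sq, mul_comm (2 : F), Finset.sum_add_distrib, Finset.sum_sub_distrib]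
  ring

/-- Let `F` be a field extending `ℝ` and `n ≥ 1`. For points `c₁,...,c_{n+1} ∈ Fⁿ`,
the square of the determinant of the `(n+1)×(n+1)` matrix whose `i`-th row is
`(z_{i,1},...,z_{i,n},1)` equals `((−1)^{n+1}/2ⁿ) · Δ(c₁,...,c_{n+1})`. -/
theorem stmt19 (F : Type*) [Field F] [Algebra ℝ F] (n : ℕ) (hn : 1 ≤ n)
    (c : Fin (n + 1) → Fin n → F) :
    (Matrix.det (Matrix.of fun i j : Fin (n + 1) =>
        if h : (j : ℕ) < n then c i ⟨(j : ℕ), h⟩ else 1)) ^ 2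
      = (-1) ^ (n + 1) / 2 ^ n * cayleyMenger F n (n + 1) c := by
  have : CharZero F := charZero_of_injective_algebraMap (algebraMap ℝ F).injective
  have hprod : ∏ k, polarDiagonal F n k = (-2) ^ n := by
    simp [polarDiagonal, Fin.prod_cons, Fin.prod_snoc]
  change (affineMatrix c).det ^ 2 = _
  rw [cayleyMenger_eq_det_mul, Matrix.det_mul, Matrix.det_mul, Matrix.det_diagonal, hprod,
    Matrix.det_permute, Matrix.det_transpose, det_paraboloidMatrix,
    Equiv.Perm.sign_swap (Fin.last_pos).ne, neg_pow 2 n]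
  have hsign : ((-1 : F) ^ n) ^ 2 = 1 := by rw [← pow_mul, mul_comm, pow_mul]; simp
  push_cast
  field_simp
  linear_combination (-(affineMatrix c).det ^ 2) * hsign
end
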